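/- arXiv:2012.10304 — 6 statements merged into one kernel-verified Lean document; each statement's English description precedes it below -/
import Mathlib

section
/- Fix real numbers x2, x3, y1, y2, y3 with Z ≠ 0 (where Z := x3 − y3). Then for every real x1, setting X := x1 − y1, Y := x2 − y2 and R := sqrt(X² + Y² + Z²), the function x1 ↦ X·atanh(Y/R) + Y·atanh(X/R) − Z·atan((Y/R)·(X/Z)) has derivative atanh(Y/R) at x1. -/
/-- The real inverse hyperbolic tangent. -/
noncomputable def atanh (x : ℝ) : ℝ := Real.log ((1 + x) / (1 - x)) / 2

lemma hasDerivAt_atanh_aux {u : ℝ} (hu : u ^ 2 < 1) : HasDerivAt atanh (1 / (1 - u ^ 2)) u := by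
  have h1 : 0 < 1 - u := by nlinarith
  have h2 : 0 < 1 + u := by nlinarith
  have h3 : 1 - u ^ 2 ≠ 0 := by linarith
  have ha : HasDerivAt (fun x : ℝ => 1 + x) 1 u := (hasDerivAt_id u).const_add 1
  have hb : HasDerivAt (fun x : ℝ => 1 - x) (-1) u := (hasDerivAt_id u).const_sub 1
  have hd := ((ha.div hb h1.ne').log (div_pos h2 h1).ne').div_const 2
  refine hd.congr_deriv ?_
  have e : 1 - u ^ 2 = (1 - u) * (1 + u) := by ring
  rw [e]
  simp only [Pi.div_apply]
  have := h1.ne'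
  have := h2.ne'
  field_simp
  ring

lemma main_aux (Y Z : ℝ) (hZ : Z ≠ 0) (y x : ℝ) :
    HasDerivAt (fun t : ℝ =>
        (t - y) * atanh (Y / Real.sqrt ((t - y) ^ 2 + Y ^ 2 + Z ^ 2))
          + Y * atanh ((t - y) / Real.sqrt ((t - y) ^ 2 + Y ^ 2 + Z ^ 2))
          - Z * Real.arctan (Y / Real.sqrt ((t - y) ^ 2 + Y ^ 2 + Z ^ 2) * ((t - y) / Z)))
      (atanh (Y / Real.sqrt ((x - y) ^ 2 + Y ^ 2 + Z ^ 2))) x := by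
  have hZ2 : 0 < Z ^ 2 := by positivity
  have hS : 0 < (x - y) ^ 2 + Y ^ 2 + Z ^ 2 := by positivity
  have hX : HasDerivAt (fun t : ℝ => t - y) 1 x := (hasDerivAt_id x).sub_const y
  have hR := (((hX.pow 2).add_const (Y ^ 2)).add_const (Z ^ 2)).sqrt hS.ne'
  simp only [Pi.pow_apply] at hR
  have hRp := Real.sqrt_pos.2 hS
  have hRs := Real.sq_sqrt hS.le
  set R : ℝ → ℝ := fun t => Real.sqrt ((t - y) ^ 2 + Y ^ 2 + Z ^ 2) with hRdef
  set r := Real.sqrt ((x - y) ^ 2 + Y ^ 2 + Z ^ 2) with hr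
  have hRx : R x = r := rfl
  have hR' : HasDerivAt R ((x - y) / r) x := by
    refine hR.congr_deriv ?_
    field_simp
    norm_num
    ring
  clear hR
  have hR0 : R x ≠ 0 := hRp.ne'
  have hr0 : r ≠ 0 := hRp.ne'
  have hA := (hasDerivAt_const x Y).div hR' hR0
  have hB := hX.div hR' hR0
  have hA1 : (Y / r) ^ 2 < 1 := by
    rw [div_pow, div_lt_one (by positivity), hRs]; nlinarith [sq_nonneg (x - y)]
  have hB1 : ((x - y) / r) ^ 2 < 1 := by
    rw [div_pow, div_lt_one (by positivity), hRs]; nlinarith [sq_nonneg Y]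
  have hAt := HasDerivAt.comp x (hasDerivAt_atanh_aux hA1) hA
  have hBt := HasDerivAt.comp x (hasDerivAt_atanh_aux hB1) hB
  have hC := (hA.mul (hX.div_const Z)).arctan
  have hF := ((hX.mul hAt).add (hBt.const_mul Y)).sub (hC.const_mul Z)
  refine hF.congr_deriv ?_
  simp only [Function.comp_apply, Pi.div_apply, Pi.mul_apply, hRx]
  generalize hXX : x - y = X at *
  have e1 : 1 - (Y / r) ^ 2 = (X ^ 2 + Z ^ 2) / r ^ 2 := by
    field_simp; linarith
  have e2 : 1 - (X / r) ^ 2 = (Y ^ 2 + Z ^ 2) / r ^ 2 := by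
    field_simp; linarith
  have e3 : 1 + (Y / r * (X / Z)) ^ 2 = (X ^ 2 + Z ^ 2) * (Y ^ 2 + Z ^ 2) / (r ^ 2 * Z ^ 2) := by
    field_simp; rw [hRs]; ring
  have e4 : (1 * r - X * (X / r)) = (Y ^ 2 + Z ^ 2) / r := by
    field_simp; linarith
  have e5 : (0 * r - Y * (X / r)) / r ^ 2 * (X / Z) + Y / r * (1 / Z)
      = Y * (Y ^ 2 + Z ^ 2) / (r ^ 3 * Z) := by
    field_simp; rw [hRs]; ring
  have p1 : X ^ 2 + Z ^ 2 ≠ 0 := by positivity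
  have p2 : Y ^ 2 + Z ^ 2 ≠ 0 := by positivity
  rw [e1, e2, e3, e4, e5]
  field_simp
  ring

theorem stmt_3 (x2 x3 y1 y2 y3 : ℝ) (h : x3 - y3 ≠ 0) (x1 : ℝ) :
    HasDerivAt (fun t : ℝ =>
        (t - y1) * atanh ((x2 - y2) / Real.sqrt ((t - y1) ^ 2 + (x2 - y2) ^ 2 + (x3 - y3) ^ 2))
          + (x2 - y2) * atanh ((t - y1) / Real.sqrt ((t - y1) ^ 2 + (x2 - y2) ^ 2 + (x3 - y3) ^ 2))
          - (x3 - y3) * Real.arctan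
              ((x2 - y2) / Real.sqrt ((t - y1) ^ 2 + (x2 - y2) ^ 2 + (x3 - y3) ^ 2)
                * ((t - y1) / (x3 - y3))))
      (atanh ((x2 - y2) / Real.sqrt ((x1 - y1) ^ 2 + (x2 - y2) ^ 2 + (x3 - y3) ^ 2))) x1 := by
  exact main_aux (x2 - y2) (x3 - y3) h y1 x1
end

section
/- Fix real numbers x2, x3, y1, y2, y3 with Z ≠ 0 (where Z := x3 − y3). Then for every real x1, setting X := x1 − y1, Y := x2 − y2 and R := sqrt(X² + Y² + Z²), the function x1 ↦ X·atan((X/R)·(Y/Z)) + Z·atanh(Y/R) has derivative atan((X/R)·(Y/Z)) at x1. -/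
theorem atanh_hasDerivAt {x : ℝ} (h1 : -1 < x) (h2 : x < 1) :
    HasDerivAt atanh (1 / (1 - x ^ 2)) x := by
  have a : (1 + x) ≠ 0 := by linarith
  have b : (1 - x) ≠ 0 := by linarith
  have c : (1 - x ^ 2) ≠ 0 := by
    have : (1 - x ^ 2) = (1 + x) * (1 - x) := by ring
    rw [this]; exact mul_ne_zero a b
  have H := ((((hasDerivAt_id x).const_add 1).div ((hasDerivAt_id x).const_sub 1) b).log
    (div_ne_zero a b)).div_const 2
  refine HasDerivAt.congr_deriv (f' := _) H ?_
  simp only [id, Pi.div_apply]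
  field_simp
  ring

theorem stmt_5 (x2 x3 y1 y2 y3 : ℝ) (h : x3 - y3 ≠ 0) (x1 : ℝ) :
    HasDerivAt (fun t : ℝ =>
        (t - y1) * Real.arctan
            ((t - y1) / Real.sqrt ((t - y1) ^ 2 + (x2 - y2) ^ 2 + (x3 - y3) ^ 2)
              * ((x2 - y2) / (x3 - y3)))
          + (x3 - y3) * atanh ((x2 - y2) / Real.sqrt ((t - y1) ^ 2 + (x2 - y2) ^ 2 + (x3 - y3) ^ 2)))
      (Real.arctan
        ((x1 - y1) / Real.sqrt ((x1 - y1) ^ 2 + (x2 - y2) ^ 2 + (x3 - y3) ^ 2)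
          * ((x2 - y2) / (x3 - y3)))) x1 := by
  set Y := x2 - y2 with hY
  set Z := x3 - y3 with hZ
  have hZ2 : 0 < Z ^ 2 := by positivity
  have hpos : 0 < (x1 - y1) ^ 2 + Y ^ 2 + Z ^ 2 := by positivity
  have hX : HasDerivAt (fun t : ℝ => t - y1) 1 x1 := (hasDerivAt_id x1).sub_const y1
  have hS : HasDerivAt (fun t : ℝ => Real.sqrt ((t - y1) ^ 2 + Y ^ 2 + Z ^ 2))
      ((x1 - y1) / Real.sqrt ((x1 - y1) ^ 2 + Y ^ 2 + Z ^ 2)) x1 := by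
    have := (((hX.pow 2).add_const (Y ^ 2)).add_const (Z ^ 2)).sqrt hpos.ne'
    refine HasDerivAt.congr_deriv this ?_
    simp only [Pi.pow_apply]
    have := (Real.sqrt_pos.2 hpos).ne'
    field_simp
    norm_num
    ring
  have hRpos := Real.sqrt_pos.2 hpos
  have hR2 := Real.sq_sqrt hpos.le
  have hA := hX.mul (((hX.div hS hRpos.ne').mul_const (Y / Z)).arctan)
  have hlt : |Y| < Real.sqrt ((x1 - y1) ^ 2 + Y ^ 2 + Z ^ 2) := by
    apply Real.lt_sqrt_of_sq_lt
    rw [sq_abs]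
    nlinarith [sq_nonneg (x1 - y1)]
  have hlt' := abs_lt.1 hlt
  have hb1 : -1 < Y / Real.sqrt ((x1 - y1) ^ 2 + Y ^ 2 + Z ^ 2) := by
    rw [lt_div_iff₀ hRpos]; linarith
  have hb2 : Y / Real.sqrt ((x1 - y1) ^ 2 + Y ^ 2 + Z ^ 2) < 1 := by
    rw [div_lt_iff₀ hRpos]; linarith
  have hB := ((atanh_hasDerivAt hb1 hb2).comp x1
    ((hasDerivAt_const x1 Y).div hS hRpos.ne')).const_mul Z
  refine HasDerivAt.congr_deriv (hA.add hB) ?_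
  simp only [Pi.div_apply]
  generalize Real.sqrt ((x1 - y1) ^ 2 + Y ^ 2 + Z ^ 2) = R at *
  generalize x1 - y1 = X at *
  have hR := hRpos.ne'
  have hW : X ^ 2 + Z ^ 2 ≠ 0 := by positivity
  have hV : Y ^ 2 + Z ^ 2 ≠ 0 := by positivity
  have e1 : 1 + (X / R * (Y / Z)) ^ 2 = (X ^ 2 + Z ^ 2) * (Y ^ 2 + Z ^ 2) / (R ^ 2 * Z ^ 2) := by
    field_simp
    rw [hR2]; ring
  have e2 : 1 - (Y / R) ^ 2 = (X ^ 2 + Z ^ 2) / R ^ 2 := by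
    field_simp
    rw [hR2]; ring
  have e3 : 1 * R - X * (X / R) = (Y ^ 2 + Z ^ 2) / R := by
    field_simp
    rw [hR2]; ring
  rw [e1, e2, e3]
  field_simp
  ring
end

section
/- Fix real numbers x1, x3, y1, y2, y3 with Z ≠ 0 (where Z := x3 − y3). Then for every real x2, setting X := x1 − y1, Y := x2 − y2 and R := sqrt(X² + Y² + Z²), the function x2 ↦ Y·atanh(X/R) + X·atanh(Y/R) − Z·atan((X/R)·(Y/Z)) has derivative atanh(X/R) at x2. -/
theorem atanh_hasDerivAt_s9 {f : ℝ → ℝ} {f' t : ℝ} (hf : HasDerivAt f f' t) (h : f t ^ 2 < 1) :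
    HasDerivAt (fun s => atanh (f s)) (f' / (1 - f t ^ 2)) t := by
  have h1 : 0 < 1 + f t := by nlinarith
  have h2 : 0 < 1 - f t := by nlinarith
  have h3 := (((hf.const_add 1).div (hf.const_sub 1) h2.ne').log (div_pos h1 h2).ne').div_const 2
  refine h3.congr_deriv ?_
  have h4 : 1 - f t ^ 2 = (1 + f t) * (1 - f t) := by ring
  rw [h4]
  simp only [Pi.div_apply]
  field_simp
  ring

theorem stmt_9 (x1 x3 y1 y2 y3 : ℝ) (h : x3 - y3 ≠ 0) (x2 : ℝ) :
    HasDerivAt (fun t : ℝ =>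
        (t - y2) * atanh ((x1 - y1) / Real.sqrt ((x1 - y1) ^ 2 + (t - y2) ^ 2 + (x3 - y3) ^ 2))
          + (x1 - y1) * atanh ((t - y2) / Real.sqrt ((x1 - y1) ^ 2 + (t - y2) ^ 2 + (x3 - y3) ^ 2))
          - (x3 - y3) * Real.arctan
              ((x1 - y1) / Real.sqrt ((x1 - y1) ^ 2 + (t - y2) ^ 2 + (x3 - y3) ^ 2)
                * ((t - y2) / (x3 - y3))))
      (atanh ((x1 - y1) / Real.sqrt ((x1 - y1) ^ 2 + (x2 - y2) ^ 2 + (x3 - y3) ^ 2))) x2 := by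
  generalize x1 - y1 = X at *
  generalize x3 - y3 = Z at *
  have hZ : 0 < Z ^ 2 := by positivity
  have hY : HasDerivAt (fun t : ℝ => t - y2) 1 x2 := (hasDerivAt_id x2).sub_const y2
  have hpos : 0 < X ^ 2 + (x2 - y2) ^ 2 + Z ^ 2 := by positivity
  have hR0 := (((hY.pow 2).const_add (X ^ 2)).add_const (Z ^ 2)).sqrt hpos.ne'
  have hRpos : 0 < √(X ^ 2 + (x2 - y2) ^ 2 + Z ^ 2) := Real.sqrt_pos.2 hpos
  have hsq : √(X ^ 2 + (x2 - y2) ^ 2 + Z ^ 2) ^ 2 = X ^ 2 + (x2 - y2) ^ 2 + Z ^ 2 :=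
    Real.sq_sqrt hpos.le
  have hR : HasDerivAt (fun t : ℝ => √(X ^ 2 + (t - y2) ^ 2 + Z ^ 2))
      ((x2 - y2) / √(X ^ 2 + (x2 - y2) ^ 2 + Z ^ 2)) x2 := by
    refine hR0.congr_deriv ?_
    simp only [Pi.pow_apply]
    field_simp
    norm_num
    ring
  have hA := (hasDerivAt_const x2 X).fun_div hR hRpos.ne'
  have hB := hY.fun_div hR hRpos.ne'
  have hC := (hA.fun_mul (hY.div_const Z)).arctan
  have hA' := atanh_hasDerivAt_s9 hA (by rw [div_pow, hsq, div_lt_one hpos]; nlinarith [sq_nonneg (x2 - y2)])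
  have hB' := atanh_hasDerivAt_s9 hB (by rw [div_pow, hsq, div_lt_one hpos]; nlinarith [sq_nonneg X])
  refine (((hY.fun_mul hA').fun_add (hB'.const_mul X)).fun_sub (hC.const_mul Z)).congr_deriv ?_
  generalize √(X ^ 2 + (x2 - y2) ^ 2 + Z ^ 2) = R at *
  clear hA hB hC hA' hB' hR hR0 hY
  generalize x2 - y2 = Y at *
  have p1 : 0 < Y ^ 2 + Z ^ 2 := by positivity
  have p2 : 0 < X ^ 2 + Z ^ 2 := by positivity
  have e1 : 1 - (X / R) ^ 2 = (Y ^ 2 + Z ^ 2) / R ^ 2 := by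
    field_simp; linarith
  have e2 : 1 - (Y / R) ^ 2 = (X ^ 2 + Z ^ 2) / R ^ 2 := by
    field_simp; linarith
  have e3 : 1 + (X / R * (Y / Z)) ^ 2 = (Y ^ 2 + Z ^ 2) * (X ^ 2 + Z ^ 2) / (R ^ 2 * Z ^ 2) := by
    field_simp; rw [hsq]; ring
  have e4 : (1 * R - Y * (Y / R)) / R ^ 2 = (X ^ 2 + Z ^ 2) / R ^ 3 := by
    field_simp; linarith
  have e5 : (0 * R - X * (Y / R)) / R ^ 2 = - (X * Y) / R ^ 3 := by
    field_simp; ring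
  have e6 : - (X * Y) / R ^ 3 * (Y / Z) + X / R * (1 / Z) = X * (X ^ 2 + Z ^ 2) / (R ^ 3 * Z) := by
    field_simp; rw [hsq]; ring
  rw [e1, e2, e3, e4, e5, e6]
  field_simp
  ring
end

section
/- Let P₁, P₂, P₃, P₄, P₅, P₆, P₇, P₈ be polynomials with rational coefficients in the six variables x1, x2, x3, y1, y2, y3. Then there exist polynomials Q₁, …, Q₈ with rational coefficients in the same six variables such that, on the open set of points (x1, x2, x3, y1, y2, y3) ∈ ℝ⁶ where X ≠ 0, Y ≠ 0 and Z ≠ 0 (with X := x1 − y1, Y := x2 − y2, Z := x3 − y3 and R := sqrt(X² + Y² + Z²)), the function F̃ := Q₁·(1/R) + Q₂·R + Q₃·atanh(X/R) + Q₄·atanh(Y/R) + Q₅·atanh(Z/R) + Q₆·atan((X/R)·(Y/Z)) + Q₇·atan((X/R)·(Z/Y)) + Q₈·atan((Y/R)·(Z/X)) has partial derivative with respect to x1 equal to F := P₁·(1/R) + P₂·R + P₃·atanh(X/R) + P₄·atanh(Y/R) + P₅·atanh(Z/R) + P₆·atan((X/R)·(Y/Z)) + P₇·atan((X/R)·(Z/Y))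 + P₈·atan((Y/R)·(Z/X)). -/
/-- Evaluation of a rational-coefficient polynomial in the six variables
`x1, x2, x3, y1, y2, y3` at a real point. -/
noncomputable def pev (P : MvPolynomial (Fin 6) ℚ) (x1 x2 x3 y1 y2 y3 : ℝ) : ℝ :=
  MvPolynomial.aeval ![x1, x2, x3, y1, y2, y3] P

/-- A function of the shape
`P₁/R + P₂·R + P₃·atanh(X/R) + P₄·atanh(Y/R) + P₅·atanh(Z/R)
  + P₆·atan((X/R)(Y/Z)) + P₇·atan((X/R)(Z/Y)) + P₈·atan((Y/R)(Z/X))`. -/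
noncomputable def shapeF (P₁ P₂ P₃ P₄ P₅ P₆ P₇ P₈ : MvPolynomial (Fin 6) ℚ)
    (x1 x2 x3 y1 y2 y3 : ℝ) : ℝ :=
  let X := x1 - y1
  let Y := x2 - y2
  let Z := x3 - y3
  let R := Real.sqrt (X ^ 2 + Y ^ 2 + Z ^ 2)
  pev P₁ x1 x2 x3 y1 y2 y3 * (1 / R)
    + pev P₂ x1 x2 x3 y1 y2 y3 * R
    + pev P₃ x1 x2 x3 y1 y2 y3 * atanh (X / R)
    + pev P₄ x1 x2 x3 y1 y2 y3 * atanh (Y / R)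
    + pev P₅ x1 x2 x3 y1 y2 y3 * atanh (Z / R)
    + pev P₆ x1 x2 x3 y1 y2 y3 * Real.arctan (X / R * (Y / Z))
    + pev P₇ x1 x2 x3 y1 y2 y3 * Real.arctan (X / R * (Z / Y))
    + pev P₈ x1 x2 x3 y1 y2 y3 * Real.arctan (Y / R * (Z / X))

open MvPolynomial in
noncomputable def pX : MvPolynomial (Fin 6) ℚ := X 0 - X 3
open MvPolynomial in
noncomputable def pY : MvPolynomial (Fin 6) ℚ := X 1 - X 4
open MvPolynomial in
noncomputable def pZ : MvPolynomial (Fin 6) ℚ := X 2 - X 5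

noncomputable def rR (x1 x2 x3 y1 y2 y3 : ℝ) : ℝ :=
  Real.sqrt ((x1 - y1) ^ 2 + (x2 - y2) ^ 2 + (x3 - y3) ^ 2)

noncomputable def bas (i : Fin 8) (x1 x2 x3 y1 y2 y3 : ℝ) : ℝ :=
  ![1 / rR x1 x2 x3 y1 y2 y3, rR x1 x2 x3 y1 y2 y3,
    atanh ((x1 - y1) / rR x1 x2 x3 y1 y2 y3),
    atanh ((x2 - y2) / rR x1 x2 x3 y1 y2 y3),
    atanh ((x3 - y3) / rR x1 x2 x3 y1 y2 y3),
    Real.arctan ((x1 - y1) / rR x1 x2 x3 y1 y2 y3 * ((x2 - y2) / (x3 - y3))),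
    Real.arctan ((x1 - y1) / rR x1 x2 x3 y1 y2 y3 * ((x3 - y3) / (x2 - y2))),
    Real.arctan ((x2 - y2) / rR x1 x2 x3 y1 y2 y3 * ((x3 - y3) / (x1 - y1)))] i

noncomputable def wZ (x1 x2 x3 y1 y2 y3 : ℝ) : ℝ :=
  (x2 - y2) / (rR x1 x2 x3 y1 y2 y3 * ((x1 - y1) ^ 2 + (x3 - y3) ^ 2))
noncomputable def wY (x1 x2 x3 y1 y2 y3 : ℝ) : ℝ :=
  (x3 - y3) / (rR x1 x2 x3 y1 y2 y3 * ((x1 - y1) ^ 2 + (x2 - y2) ^ 2))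

noncomputable def basd (i : Fin 8) (x1 x2 x3 y1 y2 y3 : ℝ) : ℝ :=
  ![-(x1 - y1) / rR x1 x2 x3 y1 y2 y3 ^ 3, (x1 - y1) / rR x1 x2 x3 y1 y2 y3,
    1 / rR x1 x2 x3 y1 y2 y3,
    -((x1 - y1) * wZ x1 x2 x3 y1 y2 y3),
    -((x1 - y1) * wY x1 x2 x3 y1 y2 y3),
    (x3 - y3) * wZ x1 x2 x3 y1 y2 y3,
    (x2 - y2) * wY x1 x2 x3 y1 y2 y3,
    -((x3 - y3) * wZ x1 x2 x3 y1 y2 y3) - (x2 - y2) * wY x1 x2 x3 y1 y2 y3] i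

theorem shape_eq (Q : Fin 8 → MvPolynomial (Fin 6) ℚ) (x1 x2 x3 y1 y2 y3 : ℝ) :
    shapeF (Q 0) (Q 1) (Q 2) (Q 3) (Q 4) (Q 5) (Q 6) (Q 7) x1 x2 x3 y1 y2 y3
      = ∑ i, pev (Q i) x1 x2 x3 y1 y2 y3 * bas i x1 x2 x3 y1 y2 y3 := by
  rw [Fin.sum_univ_eight]; rfl

theorem rR_pos {x1 x2 x3 y1 y2 y3 : ℝ} (hX : x1 - y1 ≠ 0) : 0 < rR x1 x2 x3 y1 y2 y3 := by
  unfold rR; positivity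

theorem rR_sq (x1 x2 x3 y1 y2 y3 : ℝ) : rR x1 x2 x3 y1 y2 y3 ^ 2 =
    (x1 - y1) ^ 2 + (x2 - y2) ^ 2 + (x3 - y3) ^ 2 := by
  unfold rR; rw [Real.sq_sqrt]; positivity

theorem rR_deriv {x1 x2 x3 y1 y2 y3 : ℝ} (hX : x1 - y1 ≠ 0) :
    HasDerivAt (fun t => rR t x2 x3 y1 y2 y3) ((x1 - y1) / rR x1 x2 x3 y1 y2 y3) x1 := by
  unfold rR
  have h : HasDerivAt (fun t : ℝ => (t - y1) ^ 2 + (x2 - y2) ^ 2 + (x3 - y3) ^ 2)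
      (2 * (x1 - y1)) x1 := by
    have := ((((hasDerivAt_id x1).sub_const y1).pow 2).add_const ((x2 - y2) ^ 2)).add_const
      ((x3 - y3) ^ 2)
    simpa using this
  have := h.sqrt (by positivity)
  convert this using 1
  have : √((x1 - y1) ^ 2 + (x2 - y2) ^ 2 + (x3 - y3) ^ 2) ≠ 0 := by positivity
  field_simp

theorem atanh_deriv {f : ℝ → ℝ} {f' x : ℝ} (hf : HasDerivAt f f' x) (h : f x ^ 2 < 1) :
    HasDerivAt (fun t => atanh (f t)) (f' / (1 - f x ^ 2)) x := by
  have h1 : 0 < 1 + f x := by nlinarith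
  have h2 : 0 < 1 - f x := by nlinarith
  unfold atanh
  have := (((hf.const_add 1).div (hf.const_sub 1) h2.ne').log (div_pos h1 h2).ne').div_const 2
  refine this.congr_deriv ?_
  have h3 : 1 - f x ^ 2 ≠ 0 := by nlinarith
  simp only [Pi.div_apply]
  rw [show 1 - f x ^ 2 = (1 + f x) * (1 - f x) by ring]
  have := h1.ne'
  have := h2.ne'
  field_simp
  ring

theorem bas_deriv (i : Fin 8) {x1 x2 x3 y1 y2 y3 : ℝ} (hX : x1 - y1 ≠ 0) (hY : x2 - y2 ≠ 0)
    (hZ : x3 - y3 ≠ 0) :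
    HasDerivAt (fun t => bas i t x2 x3 y1 y2 y3) (basd i x1 x2 x3 y1 y2 y3) x1 := by
  have hR := rR_deriv (x2 := x2) (x3 := x3) (y2 := y2) (y3 := y3) hX
  have hp := rR_pos (x2 := x2) (x3 := x3) (y2 := y2) (y3 := y3) hX
  have hs := rR_sq x1 x2 x3 y1 y2 y3
  have hI : HasDerivAt (fun t : ℝ => t - y1) 1 x1 := (hasDerivAt_id x1).sub_const y1
  have hXp : 0 < (x1 - y1) ^ 2 := by positivity
  have hYp : 0 < (x2 - y2) ^ 2 := by positivity
  have hZp : 0 < (x3 - y3) ^ 2 := by positivity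
  unfold basd wZ wY bas
  generalize hr : rR x1 x2 x3 y1 y2 y3 = r at *
  have e1 : (x1 - y1) ^ 2 + (x3 - y3) ^ 2 ≠ 0 := by positivity
  have e2 : (x1 - y1) ^ 2 + (x2 - y2) ^ 2 ≠ 0 := by positivity
  have e3 : (x2 - y2) ^ 2 + (x3 - y3) ^ 2 ≠ 0 := by positivity
  fin_cases i
  · have := hR.inv (by rw [hr]; exact hp.ne')
    simp only [Fin.zero_eta, Matrix.cons_val, one_div]
    refine this.congr_deriv ?_
    rw [hr]; field_simp
  · exact hR
  · have h := hI.div hR (by rw [hr]; exact hp.ne')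
    have := atanh_deriv h (by
      simp only [Pi.div_apply, hr]; rw [div_pow, div_lt_one (by positivity)]; linarith)
    refine this.congr_deriv ?_
    simp only [Pi.div_apply, hr, Fin.reduceFinMk, Matrix.cons_val]
    rw [show 1 - ((x1 - y1) / r) ^ 2 = ((x2 - y2) ^ 2 + (x3 - y3) ^ 2) / r ^ 2 by
      field_simp; linarith]
    field_simp
    linarith
  · have h := (hasDerivAt_const x1 (x2 - y2)).div hR (by rw [hr]; exact hp.ne')
    have := atanh_deriv h (by
      simp only [Pi.div_apply, hr]; rw [div_pow, div_lt_one (by positivity)]; linarith)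
    refine this.congr_deriv ?_
    simp only [Pi.div_apply, hr, Fin.reduceFinMk, Matrix.cons_val]
    rw [show 1 - ((x2 - y2) / r) ^ 2 = ((x1 - y1) ^ 2 + (x3 - y3) ^ 2) / r ^ 2 by
      field_simp; linarith]
    field_simp
    ring
  · have h := (hasDerivAt_const x1 (x3 - y3)).div hR (by rw [hr]; exact hp.ne')
    have := atanh_deriv h (by
      simp only [Pi.div_apply, hr]; rw [div_pow, div_lt_one (by positivity)]; linarith)
    refine this.congr_deriv ?_
    simp only [Pi.div_apply, hr, Fin.reduceFinMk, Matrix.cons_val]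
    rw [show 1 - ((x3 - y3) / r) ^ 2 = ((x1 - y1) ^ 2 + (x2 - y2) ^ 2) / r ^ 2 by
      field_simp; linarith]
    field_simp
    ring
  · have h := ((hI.div hR (by rw [hr]; exact hp.ne')).mul_const ((x2 - y2) / (x3 - y3))).arctan
    refine h.congr_deriv ?_
    simp only [Pi.div_apply, hr, Fin.reduceFinMk, Matrix.cons_val]
    rw [show 1 + ((x1 - y1) / r * ((x2 - y2) / (x3 - y3))) ^ 2 =
      ((x1 - y1) ^ 2 + (x3 - y3) ^ 2) * ((x2 - y2) ^ 2 + (x3 - y3) ^ 2) / (r ^ 2 * (x3 - y3) ^ 2) by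
      field_simp; rw [hs]; ring]
    field_simp
    rw [hs]; ring
  · have h := ((hI.div hR (by rw [hr]; exact hp.ne')).mul_const ((x3 - y3) / (x2 - y2))).arctan
    refine h.congr_deriv ?_
    simp only [Pi.div_apply, hr, Fin.reduceFinMk, Matrix.cons_val]
    rw [show 1 + ((x1 - y1) / r * ((x3 - y3) / (x2 - y2))) ^ 2 =
      ((x1 - y1) ^ 2 + (x2 - y2) ^ 2) * ((x2 - y2) ^ 2 + (x3 - y3) ^ 2) / (r ^ 2 * (x2 - y2) ^ 2) by
      field_simp; rw [hs]; ring]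
    field_simp
    rw [hs]; ring
  · have h := (((hasDerivAt_const x1 (x2 - y2)).div hR (by rw [hr]; exact hp.ne')).mul
      ((hasDerivAt_const x1 (x3 - y3)).div hI hX)).arctan
    refine h.congr_deriv ?_
    simp only [Pi.div_apply, Pi.mul_apply, hr, Fin.reduceFinMk, Matrix.cons_val]
    rw [show 1 + ((x2 - y2) / r * ((x3 - y3) / (x1 - y1))) ^ 2 =
      ((x1 - y1) ^ 2 + (x2 - y2) ^ 2) * ((x1 - y1) ^ 2 + (x3 - y3) ^ 2) / (r ^ 2 * (x1 - y1) ^ 2) by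
      field_simp; rw [hs]; ring]
    field_simp
    rw [hs]; ring

/-- `f` has a primitive of the required shape. -/
def Prim (f : ℝ → ℝ → ℝ → ℝ → ℝ → ℝ → ℝ) : Prop :=
  ∃ Q : Fin 8 → MvPolynomial (Fin 6) ℚ, ∀ x1 x2 x3 y1 y2 y3 : ℝ,
    x1 - y1 ≠ 0 → x2 - y2 ≠ 0 → x3 - y3 ≠ 0 →
    HasDerivAt (fun t : ℝ => ∑ i, pev (Q i) t x2 x3 y1 y2 y3 * bas i t x2 x3 y1 y2 y3)
      (f x1 x2 x3 y1 y2 y3) x1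

/-- polynomials whose value does not depend on `x1`. -/
def Free (c : MvPolynomial (Fin 6) ℚ) : Prop :=
  ∀ t x1 x2 x3 y1 y2 y3 : ℝ, pev c t x2 x3 y1 y2 y3 = pev c x1 x2 x3 y1 y2 y3

theorem Prim.congr {f g : ℝ → ℝ → ℝ → ℝ → ℝ → ℝ → ℝ} (hf : Prim f)
    (h : ∀ x1 x2 x3 y1 y2 y3 : ℝ, x1 - y1 ≠ 0 → x2 - y2 ≠ 0 → x3 - y3 ≠ 0 →
      f x1 x2 x3 y1 y2 y3 = g x1 x2 x3 y1 y2 y3) : Prim g := by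
  obtain ⟨Q, hQ⟩ := hf
  exact ⟨Q, fun x1 x2 x3 y1 y2 y3 a b c => (hQ x1 x2 x3 y1 y2 y3 a b c).congr_deriv
    (h x1 x2 x3 y1 y2 y3 a b c)⟩

theorem Prim.add {f g : ℝ → ℝ → ℝ → ℝ → ℝ → ℝ → ℝ} (hf : Prim f) (hg : Prim g) :
    Prim (fun x1 x2 x3 y1 y2 y3 => f x1 x2 x3 y1 y2 y3 + g x1 x2 x3 y1 y2 y3) := by
  obtain ⟨Q, hQ⟩ := hf
  obtain ⟨S, hS⟩ := hg
  refine ⟨Q + S, fun x1 x2 x3 y1 y2 y3 a b c => ?_⟩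
  refine HasDerivAt.congr_of_eventuallyEq ((hQ x1 x2 x3 y1 y2 y3 a b c).add (hS x1 x2 x3 y1 y2 y3 a b c)) (Filter.Eventually.of_forall fun t => ?_)
  simp [pev, add_mul, Finset.sum_add_distrib]

theorem Prim.smul {f : ℝ → ℝ → ℝ → ℝ → ℝ → ℝ → ℝ} (hf : Prim f)
    {p : MvPolynomial (Fin 6) ℚ} (hp : Free p) :
    Prim (fun x1 x2 x3 y1 y2 y3 => pev p x1 x2 x3 y1 y2 y3 * f x1 x2 x3 y1 y2 y3) := by
  obtain ⟨Q, hQ⟩ := hf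
  refine ⟨fun i => p * Q i, fun x1 x2 x3 y1 y2 y3 a b c => ?_⟩
  refine HasDerivAt.congr_of_eventuallyEq ((hQ x1 x2 x3 y1 y2 y3 a b c).const_mul (pev p x1 x2 x3 y1 y2 y3)) (Filter.Eventually.of_forall fun t => ?_)
  simp only [Finset.mul_sum]
  refine Finset.sum_congr rfl fun i _ => ?_
  rw [← hp t]
  simp [pev, mul_assoc]

theorem pev_pX (x1 x2 x3 y1 y2 y3 : ℝ) : pev pX x1 x2 x3 y1 y2 y3 = x1 - y1 := by
  simp [pev, pX]
theorem pev_pY (x1 x2 x3 y1 y2 y3 : ℝ) : pev pY x1 x2 x3 y1 y2 y3 = x2 - y2 := by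
  simp [pev, pY]
theorem pev_pZ (x1 x2 x3 y1 y2 y3 : ℝ) : pev pZ x1 x2 x3 y1 y2 y3 = x3 - y3 := by
  simp [pev, pZ]
theorem pev_C (q : ℚ) (x1 x2 x3 y1 y2 y3 : ℝ) :
    pev (MvPolynomial.C q) x1 x2 x3 y1 y2 y3 = q := by
  simp [pev]
theorem pev_mul (p q) (x1 x2 x3 y1 y2 y3 : ℝ) : pev (p * q) x1 x2 x3 y1 y2 y3 =
    pev p x1 x2 x3 y1 y2 y3 * pev q x1 x2 x3 y1 y2 y3 := by simp [pev]
theorem pev_add (p q) (x1 x2 x3 y1 y2 y3 : ℝ) : pev (p + q) x1 x2 x3 y1 y2 y3 =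
    pev p x1 x2 x3 y1 y2 y3 + pev q x1 x2 x3 y1 y2 y3 := by simp [pev]
theorem pev_pow (p) (n : ℕ) (x1 x2 x3 y1 y2 y3 : ℝ) : pev (p ^ n) x1 x2 x3 y1 y2 y3 =
    pev p x1 x2 x3 y1 y2 y3 ^ n := by simp [pev]

theorem pev_neg (p) (x1 x2 x3 y1 y2 y3 : ℝ) : pev (-p) x1 x2 x3 y1 y2 y3 =
    -pev p x1 x2 x3 y1 y2 y3 := by simp [pev]
theorem pev_one (x1 x2 x3 y1 y2 y3 : ℝ) : pev 1 x1 x2 x3 y1 y2 y3 = 1 := by simp [pev]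

theorem free_Y : Free pY := by intro t x1 x2 x3 y1 y2 y3; simp [pev_pY]
theorem free_Z : Free pZ := by intro t x1 x2 x3 y1 y2 y3; simp [pev_pZ]
theorem free_C (q : ℚ) : Free (MvPolynomial.C q) := by
  intro t x1 x2 x3 y1 y2 y3; simp [pev_C]
theorem Free.mul {p q} (hp : Free p) (hq : Free q) : Free (p * q) := by
  intro t x1 x2 x3 y1 y2 y3; rw [pev_mul, pev_mul, hp t x1, hq t x1]
theorem Free.add {p q} (hp : Free p) (hq : Free q) : Free (p + q) := by
  intro t x1 x2 x3 y1 y2 y3; rw [pev_add, pev_add, hp t x1, hq t x1]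
theorem free_X (i : Fin 6) (hi : i ≠ 0) : Free (MvPolynomial.X i) := by
  intro t x1 x2 x3 y1 y2 y3
  fin_cases i <;> simp_all [pev]

theorem prim_bas (i : Fin 8) (k : ℕ) : Prim (fun x1 x2 x3 y1 y2 y3 =>
    k * (x1 - y1) ^ (k - 1) * bas i x1 x2 x3 y1 y2 y3
      + (x1 - y1) ^ k * basd i x1 x2 x3 y1 y2 y3) := by
  refine ⟨Pi.single i (pX ^ k), fun x1 x2 x3 y1 y2 y3 a b c => ?_⟩
  have hI : HasDerivAt (fun t : ℝ => (t - y1) ^ k) (k * (x1 - y1) ^ (k - 1)) x1 := by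
    exact (((hasDerivAt_id x1).sub_const y1).pow k).congr_deriv (by simp)
  refine HasDerivAt.congr_of_eventuallyEq (hI.mul (bas_deriv i a b c)) (Filter.Eventually.of_forall fun t => ?_)
  simp only [Pi.mul_apply]
  rw [Finset.sum_eq_single i]
  · simp [pev_pow, pev_pX]
  · intro j _ hj; simp [Pi.single_eq_of_ne hj, pev]
  · simp

theorem prim_inv : ∀ n : ℕ, Prim (fun x1 x2 x3 y1 y2 y3 =>
    (x1 - y1) ^ n / rR x1 x2 x3 y1 y2 y3)
  | 0 => (prim_bas 2 0).congr (by intros; simp [basd])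
  | 1 => (prim_bas 1 0).congr (by intros; simp [basd])
  | m + 2 => by
    have h1 := (prim_bas 1 (m + 1)).smul (free_C (1 / (m + 2)))
    have h2 := (prim_inv m).smul ((free_C (-(m + 1) / (m + 2))).mul
      ((free_Y.mul free_Y).add (free_Z.mul free_Z)))
    refine (h1.add h2).congr ?_
    intro x1 x2 x3 y1 y2 y3 a b c
    have hp := rR_pos (x2 := x2) (x3 := x3) (y2 := y2) (y3 := y3) a
    have hs := rR_sq x1 x2 x3 y1 y2 y3
    simp only [pev_C, pev_mul, pev_add, pev_pY, pev_pZ, bas, basd, Matrix.cons_val]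
    generalize rR x1 x2 x3 y1 y2 y3 = r at *
    push_cast
    have : (m + 2 : ℝ) ≠ 0 := by positivity
    field_simp
    rw [hs]
    ring

theorem prim_wZ : ∀ n : ℕ, Prim (fun x1 x2 x3 y1 y2 y3 =>
    (x1 - y1) ^ (n + 1) * wZ x1 x2 x3 y1 y2 y3)
  | 0 => ((prim_bas 3 0).smul (free_C (-1))).congr (by intros; simp [basd, pev_neg, pev_one])
  | 1 => by
    refine (((prim_inv 0).smul free_Y).add
      ((prim_bas 5 0).smul ((free_C (-1)).mul free_Z))).congr ?_
    intro x1 x2 x3 y1 y2 y3 a b c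
    have hp := rR_pos (x2 := x2) (x3 := x3) (y2 := y2) (y3 := y3) a
    have e1 : (x1 - y1) ^ 2 + (x3 - y3) ^ 2 ≠ 0 := by positivity
    simp only [pev_C, pev_mul, pev_add, pev_pY, pev_pZ, bas, basd, wZ, Matrix.cons_val]
    push_cast
    field_simp
    ring
  | m + 2 => by
    refine (((prim_inv (m + 1)).smul free_Y).add
      ((prim_wZ m).smul ((free_C (-1)).mul (free_Z.mul free_Z)))).congr ?_
    intro x1 x2 x3 y1 y2 y3 a b c
    have hp := rR_pos (x2 := x2) (x3 := x3) (y2 := y2) (y3 := y3) a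
    have e1 : (x1 - y1) ^ 2 + (x3 - y3) ^ 2 ≠ 0 := by positivity
    simp only [pev_C, pev_mul, pev_add, pev_pY, pev_pZ, wZ]
    push_cast
    field_simp
    ring

theorem prim_wY : ∀ n : ℕ, Prim (fun x1 x2 x3 y1 y2 y3 =>
    (x1 - y1) ^ (n + 1) * wY x1 x2 x3 y1 y2 y3)
  | 0 => ((prim_bas 4 0).smul (free_C (-1))).congr (by intros; simp [basd, pev_neg, pev_one])
  | 1 => by
    refine (((prim_inv 0).smul free_Z).add
      ((prim_bas 6 0).smul ((free_C (-1)).mul free_Y))).congr ?_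
    intro x1 x2 x3 y1 y2 y3 a b c
    have hp := rR_pos (x2 := x2) (x3 := x3) (y2 := y2) (y3 := y3) a
    have e1 : (x1 - y1) ^ 2 + (x2 - y2) ^ 2 ≠ 0 := by positivity
    simp only [pev_C, pev_mul, pev_add, pev_pY, pev_pZ, bas, basd, wY, Matrix.cons_val]
    push_cast
    field_simp
    ring
  | m + 2 => by
    refine (((prim_inv (m + 1)).smul free_Z).add
      ((prim_wY m).smul ((free_C (-1)).mul (free_Y.mul free_Y)))).congr ?_
    intro x1 x2 x3 y1 y2 y3 a b c
    have hp := rR_pos (x2 := x2) (x3 := x3) (y2 := y2) (y3 := y3) a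
    have e1 : (x1 - y1) ^ 2 + (x2 - y2) ^ 2 ≠ 0 := by positivity
    simp only [pev_C, pev_mul, pev_add, pev_pY, pev_pZ, wY]
    push_cast
    field_simp
    ring

/-- integration by parts -/
theorem prim_parts (i : Fin 8) (n : ℕ) (h : Prim (fun x1 x2 x3 y1 y2 y3 =>
      (x1 - y1) ^ (n + 1) * basd i x1 x2 x3 y1 y2 y3)) :
    Prim (fun x1 x2 x3 y1 y2 y3 => (x1 - y1) ^ n * bas i x1 x2 x3 y1 y2 y3) := by
  refine (((prim_bas i (n + 1)).smul (free_C (1 / (n + 1)))).add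
    (h.smul (free_C (-1 / (n + 1))))).congr ?_
  intro x1 x2 x3 y1 y2 y3 a b c
  simp only [pev_C, Nat.add_sub_cancel]
  push_cast
  have : (n + 1 : ℝ) ≠ 0 := by positivity
  field_simp
  ring

theorem prim_pow (i : Fin 8) (n : ℕ) : Prim (fun x1 x2 x3 y1 y2 y3 =>
    (x1 - y1) ^ n * bas i x1 x2 x3 y1 y2 y3) := by
  fin_cases i
  · exact (prim_inv n).congr (by intros; simp [bas, div_eq_mul_inv])
  · refine ((prim_inv (n + 2)).add ((prim_inv n).smul
      ((free_Y.mul free_Y).add (free_Z.mul free_Z)))).congr ?_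
    intro x1 x2 x3 y1 y2 y3 a b c
    have hp := rR_pos (x2 := x2) (x3 := x3) (y2 := y2) (y3 := y3) a
    have hs := rR_sq x1 x2 x3 y1 y2 y3
    simp only [pev_mul, pev_add, pev_pY, pev_pZ, bas, Matrix.cons_val]
    generalize rR x1 x2 x3 y1 y2 y3 = r at *
    simp
    field_simp
    rw [hs]
    ring
  · exact prim_parts _ _ ((prim_inv (n + 1)).congr (by intros; simp [basd, div_eq_mul_inv]))
  · refine prim_parts _ _ (((prim_wZ (n + 1)).smul (free_C (-1))).congr ?_)
    intros; simp [basd, pev_neg, pev_one]; ring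
  · refine prim_parts _ _ (((prim_wY (n + 1)).smul (free_C (-1))).congr ?_)
    intros; simp [basd, pev_neg, pev_one]; ring
  · refine prim_parts _ _ (((prim_wZ n).smul free_Z).congr ?_)
    intros; simp [basd, pev_pZ]; ring
  · refine prim_parts _ _ (((prim_wY n).smul free_Y).congr ?_)
    intros; simp [basd, pev_pY]; ring
  · refine prim_parts _ _ ((((prim_wZ n).smul ((free_C (-1)).mul free_Z)).add
      ((prim_wY n).smul ((free_C (-1)).mul free_Y))).congr ?_)
    intros; simp [basd, pev_pY, pev_pZ, pev_neg]; ring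

theorem poly_ind (P : MvPolynomial (Fin 6) ℚ) : ∀ S : MvPolynomial (Fin 6) ℚ → Prop,
    (∀ p q, S p → S q → S (p + q)) → (∀ c n, Free c → S (c * pX ^ n)) → S P := by
  induction P using MvPolynomial.induction_on with
  | C a => intro S _ h; simpa using h _ 0 (free_C a)
  | add p q hp hq => intro S ha h; exact ha _ _ (hp S ha h) (hq S ha h)
  | mul_X p i hp =>
    intro S ha h
    refine hp (fun p => S (p * MvPolynomial.X i)) ?_ ?_
    · intro p q h1 h2
      rw [add_mul]; exact ha _ _ h1 h2
    · intro c n hc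
      by_cases hi : i = 0
      · subst hi
        have := ha _ _ (h c (n + 1) hc) (h (c * MvPolynomial.X 3) n (hc.mul (free_X 3 (by decide))))
        convert this using 1
        unfold pX; ring
      · convert h (c * MvPolynomial.X i) n (hc.mul (free_X i hi)) using 1
        ring

theorem prim_poly (i : Fin 8) (P : MvPolynomial (Fin 6) ℚ) : Prim (fun x1 x2 x3 y1 y2 y3 =>
    pev P x1 x2 x3 y1 y2 y3 * bas i x1 x2 x3 y1 y2 y3) := by
  refine poly_ind P (fun P => Prim (fun x1 x2 x3 y1 y2 y3 =>
    pev P x1 x2 x3 y1 y2 y3 * bas i x1 x2 x3 y1 y2 y3)) ?_ ?_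
  · intro p q hp hq
    exact (hp.add hq).congr (by intros; simp only [pev_add]; ring)
  · intro c n hc
    exact ((prim_pow i n).smul hc).congr (by intros; simp only [pev_mul, pev_pow, pev_pX]; ring)

/-- Integration with respect to `x1` is closed over functions of the shape `shapeF`. -/
theorem stmt_16 (P₁ P₂ P₃ P₄ P₅ P₆ P₇ P₈ : MvPolynomial (Fin 6) ℚ) :
    ∃ Q₁ Q₂ Q₃ Q₄ Q₅ Q₆ Q₇ Q₈ : MvPolynomial (Fin 6) ℚ,
      ∀ x1 x2 x3 y1 y2 y3 : ℝ,
        x1 - y1 ≠ 0 → x2 - y2 ≠ 0 → x3 - y3 ≠ 0 →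
        HasDerivAt (fun t : ℝ => shapeF Q₁ Q₂ Q₃ Q₄ Q₅ Q₆ Q₇ Q₈ t x2 x3 y1 y2 y3)
          (shapeF P₁ P₂ P₃ P₄ P₅ P₆ P₇ P₈ x1 x2 x3 y1 y2 y3) x1 := by
  obtain ⟨Q, hQ⟩ := ((((((((prim_poly 0 P₁).add (prim_poly 1 P₂)).add (prim_poly 2 P₃)).add
    (prim_poly 3 P₄)).add (prim_poly 4 P₅)).add (prim_poly 5 P₆)).add (prim_poly 6 P₇)).add
    (prim_poly 7 P₈))
  refine ⟨Q 0, Q 1, Q 2, Q 3, Q 4, Q 5, Q 6, Q 7, fun x1 x2 x3 y1 y2 y3 a b c => ?_⟩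
  simp only [shape_eq Q]
  exact hQ x1 x2 x3 y1 y2 y3 a b c
end

section
/- Let P₁, P₂, P₃, P₄ be polynomials with rational coefficients in the four variables x1, x2, y1, y2. Then there exist polynomials Q₁, Q₂, Q₃, Q₄ with rational coefficients in the same four variables such that, on the open set of points (x1, x2, y1, y2) ∈ ℝ⁴ where X ≠ 0 and Y ≠ 0 (with X := x1 − y1 and Y := x2 − y2), the function H̃ := Q₁·log(X² + Y²) + Q₂·atan(X/Y) + Q₃·atan(Y/X) + Q₄ has partial derivative with respect to x1 equal to H := P₁·log(X² + Y²) + P₂·atan(X/Y) + P₃·atan(Y/X) + P₄. -/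
/-- Evaluation of a rational-coefficient polynomial in the four variables
`x1, x2, y1, y2` at a real point. -/
noncomputable def pev4 (P : MvPolynomial (Fin 4) ℚ) (x1 x2 y1 y2 : ℝ) : ℝ :=
  MvPolynomial.aeval ![x1, x2, y1, y2] P

/-- A function of the shape
`P₁·log(X² + Y²) + P₂·atan(X/Y) + P₃·atan(Y/X) + P₄`. -/
noncomputable def shapeH (P₁ P₂ P₃ P₄ : MvPolynomial (Fin 4) ℚ)
    (x1 x2 y1 y2 : ℝ) : ℝ :=
  let X := x1 - y1
  let Y := x2 - y2
  pev4 P₁ x1 x2 y1 y2 * Real.log (X ^ 2 + Y ^ 2)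
    + pev4 P₂ x1 x2 y1 y2 * Real.arctan (X / Y)
    + pev4 P₃ x1 x2 y1 y2 * Real.arctan (Y / X)
    + pev4 P₄ x1 x2 y1 y2

open MvPolynomial in
theorem aux_antideriv (P : MvPolynomial (Fin 4) ℚ) : ∃ Q, pderiv 0 Q = P := by
  induction P using MvPolynomial.induction_on' with
  | monomial s c =>
    refine ⟨monomial (s + Finsupp.single 0 1) (c / ((s 0 : ℚ) + 1)), ?_⟩
    rw [pderiv_monomial]
    have h : ((s 0 : ℚ) + 1) ≠ 0 := by positivity
    congr 1
    · simp
    · simp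
      field_simp
  | add p q hp hq =>
    obtain ⟨a, ha⟩ := hp
    obtain ⟨b, hb⟩ := hq
    exact ⟨a + b, by rw [map_add, ha, hb]⟩

open MvPolynomial in
theorem aux_div (A : MvPolynomial (Fin 4) ℚ) : ∃ a b q : MvPolynomial (Fin 4) ℚ,
    pderiv 0 a = 0 ∧ pderiv 0 b = 0 ∧
    A = a + b * (X 0 - X 2) + ((X 0 - X 2) ^ 2 + (X 1 - X 3) ^ 2) * q := by
  induction A using MvPolynomial.induction_on with
  | C c => exact ⟨C c, 0, 0, by simp, by simp, by ring⟩
  | add p r hp hr =>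
    obtain ⟨a, b, q, ha, hb, h⟩ := hp
    obtain ⟨a', b', q', ha', hb', h'⟩ := hr
    refine ⟨a + a', b + b', q + q', by simp [ha, ha'], by simp [hb, hb'], ?_⟩
    linear_combination h + h'
  | mul_X p i hp =>
    obtain ⟨a, b, q, ha, hb, h⟩ := hp
    by_cases hi : i = 0
    · subst hi
      refine ⟨a * X 2 - b * (X 1 - X 3) ^ 2, b * X 2 + a, q * X 0 + b, ?_, ?_, ?_⟩
      · simp [ha, hb, Derivation.leibniz, pderiv_X, Derivation.leibniz_pow]
      · simp [ha, hb, Derivation.leibniz, pderiv_X]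
      · linear_combination X 0 * h
    · refine ⟨a * X i, b * X i, q * X i, ?_, ?_, ?_⟩
      · simp [ha, Derivation.leibniz, pderiv_X, hi]
      · simp [hb, Derivation.leibniz, pderiv_X, hi]
      · linear_combination X i * h

open MvPolynomial in
theorem aux_hasDeriv (P : MvPolynomial (Fin 4) ℚ) (x1 x2 y1 y2 : ℝ) :
    HasDerivAt (fun t : ℝ => pev4 P t x2 y1 y2) (pev4 (pderiv 0 P) x1 x2 y1 y2) x1 := by
  unfold pev4
  induction P using MvPolynomial.induction_on with
  | C c => simpa using hasDerivAt_const x1 _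
  | add p r hp hr => 
    simp only [map_add]
    exact hp.add hr
  | mul_X p i hp =>
    have hX : HasDerivAt (fun t : ℝ => (![t, x2, y1, y2] : Fin 4 → ℝ) i)
        (aeval ![x1, x2, y1, y2] (pderiv 0 (X i : MvPolynomial (Fin 4) ℚ))) x1 := by
      fin_cases i
      · exact (hasDerivAt_id x1).congr_deriv (by simp [pderiv_X])
      · simpa [pderiv_X] using hasDerivAt_const x1 x2
      · simpa [pderiv_X] using hasDerivAt_const x1 y1
      · simpa [pderiv_X] using hasDerivAt_const x1 y2
    have := hp.mul hX
    simp only [map_mul, aeval_X, Derivation.leibniz, map_add, smul_eq_mul]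
    refine HasDerivAt.congr_deriv this ?_
    ring

open MvPolynomial in
/-- Integration with respect to `x1` is closed over functions of the shape `shapeH`. -/
theorem stmt_17 (P₁ P₂ P₃ P₄ : MvPolynomial (Fin 4) ℚ) :
    ∃ Q₁ Q₂ Q₃ Q₄ : MvPolynomial (Fin 4) ℚ,
      ∀ x1 x2 y1 y2 : ℝ,
        x1 - y1 ≠ 0 → x2 - y2 ≠ 0 →
        HasDerivAt (fun t : ℝ => shapeH Q₁ Q₂ Q₃ Q₄ t x2 y1 y2)
          (shapeH P₁ P₂ P₃ P₄ x1 x2 y1 y2) x1 := by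
  obtain ⟨A₁, h₁⟩ := aux_antideriv P₁
  obtain ⟨A₂, h₂⟩ := aux_antideriv P₂
  obtain ⟨A₃, h₃⟩ := aux_antideriv P₃
  obtain ⟨a, b, q, ha, hb, hA⟩ := aux_div A₁
  obtain ⟨c, d, r, hc, hd, hB⟩ := aux_div (A₂ - A₃)
  obtain ⟨Q₄, h₄⟩ := aux_antideriv
    (P₄ - (2 * b + 2 * (X 0 - X 2) * q + (X 1 - X 3) * r))
  obtain ⟨Q₁, hQ₁⟩ : ∃ Q, Q = A₁ - a - C (1 / 2) * d * (X 1 - X 3) := ⟨_, rfl⟩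
  obtain ⟨Q₂, hQ₂⟩ : ∃ Q, Q = A₂ - c + 2 * b * (X 1 - X 3) := ⟨_, rfl⟩
  have d1 : pderiv 0 Q₁ = P₁ := by
    simp [hQ₁, h₁, ha, hd, Derivation.leibniz, pderiv_X]
  have d2 : pderiv 0 Q₂ = P₂ := by
    have : pderiv (0 : Fin 4) (2 : MvPolynomial (Fin 4) ℚ) = 0 := by
      exact pderiv_C (R := ℚ) (a := 2) (i := (0 : Fin 4))
    simp [hQ₂, h₂, hb, hc, Derivation.leibniz, pderiv_X, this]
  have hC : (2 : MvPolynomial (Fin 4) ℚ) * C (1 / 2) = 1 := by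
    have : (2 : MvPolynomial (Fin 4) ℚ) = C 2 := rfl
    rw [this, ← C_mul]; norm_num
  have key : 2 * (X 0 - X 2) * Q₁ + (X 1 - X 3) * (Q₂ - A₃)
      = ((X 0 - X 2) ^ 2 + (X 1 - X 3) ^ 2) *
        (2 * b + 2 * (X 0 - X 2) * q + (X 1 - X 3) * r) := by
    rw [hQ₁, hQ₂]
    linear_combination 2 * (X 0 - X 2) * hA + (X 1 - X 3) * hB
      - (X 0 - X 2) * d * (X 1 - X 3) * hC
  refine ⟨Q₁, Q₂, A₃, Q₄, fun x1 x2 y1 y2 hX hY => ?_⟩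
  have e1 := aux_hasDeriv Q₁ x1 x2 y1 y2
  have e2 := aux_hasDeriv Q₂ x1 x2 y1 y2
  have e3 := aux_hasDeriv A₃ x1 x2 y1 y2
  have e4 := aux_hasDeriv Q₄ x1 x2 y1 y2
  rw [d1] at e1
  rw [d2] at e2
  rw [h₃] at e3
  rw [h₄] at e4
  have key' := congrArg (fun p => pev4 p x1 x2 y1 y2) key
  have hD : (x1 - y1) ^ 2 + (x2 - y2) ^ 2 ≠ 0 := by positivity
  have l0 : HasDerivAt (fun t : ℝ => t - y1) 1 x1 := (hasDerivAt_id x1).sub_const y1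
  have l1 : HasDerivAt (fun t : ℝ => Real.log ((t - y1) ^ 2 + (x2 - y2) ^ 2))
      (2 * (x1 - y1) / ((x1 - y1) ^ 2 + (x2 - y2) ^ 2)) x1 := by
    refine HasDerivAt.congr_deriv (((l0.pow 2).add_const ((x2 - y2) ^ 2)).log hD) ?_
    simp
  have l2 : HasDerivAt (fun t : ℝ => Real.arctan ((t - y1) / (x2 - y2)))
      ((x2 - y2) / ((x1 - y1) ^ 2 + (x2 - y2) ^ 2)) x1 := by
    convert (l0.div_const (x2 - y2)).arctan using 1
    have : 1 + ((x1 - y1) / (x2 - y2)) ^ 2 ≠ 0 := by positivity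
    field_simp
    ring
  have l3 : HasDerivAt (fun t : ℝ => Real.arctan ((x2 - y2) / (t - y1)))
      (-(x2 - y2) / ((x1 - y1) ^ 2 + (x2 - y2) ^ 2)) x1 := by
    refine HasDerivAt.congr_deriv ((hasDerivAt_const x1 (x2 - y2)).div l0 hX).arctan ?_
    simp only [Pi.div_apply]
    have : 1 + ((x2 - y2) / (x1 - y1)) ^ 2 ≠ 0 := by positivity
    field_simp
    ring
  have := (((e1.mul l1).add (e2.mul l2)).add (e3.mul l3)).add e4
  unfold shapeH
  refine HasDerivAt.congr_deriv this ?_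
  simp only [pev4, map_mul, map_add, map_sub, map_pow, aeval_X, map_ofNat] at key' ⊢
  simp at key' ⊢
  generalize (aeval ![x1, x2, y1, y2]) Q₁ = u1 at *
  generalize (aeval ![x1, x2, y1, y2]) Q₂ = u2 at *
  generalize (aeval ![x1, x2, y1, y2]) A₃ = u3 at *
  generalize (aeval ![x1, x2, y1, y2]) b = v1 at *
  generalize (aeval ![x1, x2, y1, y2]) q = v2 at *
  generalize (aeval ![x1, x2, y1, y2]) r = v3 at *
  have k2 : 2 * v1 + 2 * (x1 - y1) * v2 + (x2 - y2) * v3 =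
      (2 * (x1 - y1) * u1 + (x2 - y2) * (u2 - u3)) / ((x1 - y1) ^ 2 + (x2 - y2) ^ 2) := by
    rw [eq_div_iff hD, key']; ring
  rw [k2]
  ring
end

section
/- Let Q = [a₁,b₁]×[a₂,b₂] and Q' = [a₁',b₁']×[a₂',b₂'] be closed rectangles in ℝ², and let λ = (λ₁,λ₂) and μ = (μ₁,μ₂) be multi-indices of natural numbers. Then the function (x, y) ↦ x₁^{μ₁} x₂^{μ₂} y₁^{λ₁} y₂^{λ₂} · log((x₁−y₁)² + (x₂−y₂)²) is Lebesgue integrable on Q × Q' ⊆ ℝ² × ℝ², i.e., the singular double integral of the two-dimensional Newton (logarithmic) potential of a monomial over a pair of rectangles is finite. -/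
open MeasureTheory

theorem aux_bound (u v : ℝ) :
    |Real.log (u ^ 2 + v ^ 2)| ≤ (u ^ 2 + 2 * |Real.log u|) + (v ^ 2 + 2 * |Real.log v|) := by
  have hsq : ∀ w : ℝ, |Real.log (w ^ 2)| = 2 * |Real.log w| := fun w => by
    rw [Real.log_pow, abs_mul]; norm_num
  have hu := abs_nonneg (Real.log u)
  have hv := abs_nonneg (Real.log v)
  by_cases h0 : u = 0
  · subst h0
    have := hsq v
    simp at *
    nlinarith [sq_nonneg v]
  have hup : 0 < u ^ 2 := by positivity
  have hr : 0 < u ^ 2 + v ^ 2 := by positivity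
  rw [abs_le]
  constructor
  · have h1 : Real.log (u ^ 2) ≤ Real.log (u ^ 2 + v ^ 2) :=
      Real.log_le_log hup (by nlinarith [sq_nonneg v])
    have h2 := neg_abs_le (Real.log (u ^ 2))
    rw [hsq u] at h2
    nlinarith [sq_nonneg v]
  · have := Real.log_le_sub_one_of_pos hr
    linarith

theorem aux_one (c d : ℝ) (h : c ≤ d) :
    IntegrableOn (fun u : ℝ => u ^ 2 + 2 * |Real.log u|) (Set.Icc c d) volume := by
  have h1 : IntegrableOn Real.log (Set.Icc c d) volume := by
    rw [integrableOn_Icc_iff_integrableOn_Ioc]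
    exact (intervalIntegrable_iff_integrableOn_Ioc_of_le h).1
      intervalIntegral.intervalIntegrable_log'
  have h2 : IntegrableOn (fun u : ℝ => u ^ 2) (Set.Icc c d) volume :=
    (continuous_pow 2).continuousOn.integrableOn_Icc
  exact Integrable.add h2 (Integrable.const_mul (Integrable.abs h1) 2)

theorem aux_two (c d c' d' : ℝ) (h : c ≤ d) (h' : c' ≤ d') :
    IntegrableOn (fun w : ℝ × ℝ => Real.log (w.1 ^ 2 + w.2 ^ 2))
      (Set.Icc c d ×ˢ Set.Icc c' d') volume := by
  unfold IntegrableOn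
  rw [Measure.volume_eq_prod, ← Measure.prod_restrict]
  have i1 := Integrable.comp_fst (aux_one c d h) (volume.restrict (Set.Icc c' d'))
  have i2 := Integrable.comp_snd (aux_one c' d' h') (volume.restrict (Set.Icc c d))
  refine (i1.add i2).mono' ?_ ?_
  · apply Measurable.aestronglyMeasurable
    fun_prop
  · exact Filter.Eventually.of_forall fun w => aux_bound w.1 w.2



/-- The singular double integral of the two-dimensional (logarithmic) Newton
potential of a monomial over a pair of rectangles in `ℝ²` is finite: the
integrand is Lebesgue integrable on `Q × Q'`. -/
theorem stmt_19 (a₁ b₁ a₂ b₂ a₁' b₁' a₂' b₂' : ℝ)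
    (h₁ : a₁ ≤ b₁) (h₂ : a₂ ≤ b₂) (h₁' : a₁' ≤ b₁') (h₂' : a₂' ≤ b₂')
    (lam₁ lam₂ mu₁ mu₂ : ℕ) :
    IntegrableOn
      (fun p : (ℝ × ℝ) × (ℝ × ℝ) =>
        p.1.1 ^ mu₁ * p.1.2 ^ mu₂ * p.2.1 ^ lam₁ * p.2.2 ^ lam₂
          * Real.log ((p.1.1 - p.2.1) ^ 2 + (p.1.2 - p.2.2) ^ 2))
      ((Set.Icc a₁ b₁ ×ˢ Set.Icc a₂ b₂) ×ˢ (Set.Icc a₁' b₁' ×ˢ Set.Icc a₂' b₂'))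
      volume := by

  have hI := aux_two (a₁ - b₁') (b₁ - a₁') (a₂ - b₂') (b₂ - a₂') (by linarith) (by linarith)
  haveI : IsFiniteMeasure
      ((volume : Measure (ℝ × ℝ)).restrict (Set.Icc a₁' b₁' ×ˢ Set.Icc a₂' b₂')) :=
    isFiniteMeasure_restrict.2 (isCompact_Icc.prod isCompact_Icc).measure_lt_top.ne
  have i1 := Integrable.comp_fst hI
    ((volume : Measure (ℝ × ℝ)).restrict (Set.Icc a₁' b₁' ×ˢ Set.Icc a₂' b₂'))
  rw [Measure.prod_restrict] at i1
  have mp := measurePreserving_sub_prod (volume : Measure (ℝ × ℝ)) (volume : Measure (ℝ × ℝ))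
  have i2 := (mp.restrict_preimage ((measurableSet_Icc.prod measurableSet_Icc).prod
    (measurableSet_Icc.prod measurableSet_Icc))).integrable_comp_of_integrable i1
  have i3 : IntegrableOn (fun p : (ℝ × ℝ) × (ℝ × ℝ) =>
      Real.log ((p.1.1 - p.2.1) ^ 2 + (p.1.2 - p.2.2) ^ 2))
      ((Set.Icc a₁ b₁ ×ˢ Set.Icc a₂ b₂) ×ˢ (Set.Icc a₁' b₁' ×ˢ Set.Icc a₂' b₂'))
      volume := by
    refine IntegrableOn.mono_set i2 ?_
    rintro ⟨⟨x, y⟩, ⟨z, w⟩⟩ hp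
    simp only [Set.mem_prod, Set.mem_Icc, Set.mem_preimage, Prod.mk_sub_mk] at hp ⊢
    obtain ⟨⟨⟨_, _⟩, _, _⟩, ⟨_, _⟩, _, _⟩ := hp
    refine ⟨⟨⟨?_, ?_⟩, ?_, ?_⟩, ⟨?_, ?_⟩, ?_, ?_⟩ <;> linarith
  refine IntegrableOn.continuousOn_mul (Continuous.continuousOn (by fun_prop)) i3 ?_
  exact (isCompact_Icc.prod isCompact_Icc).prod (isCompact_Icc.prod isCompact_Icc)
end
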